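/- Let X be a Lévy process with triplet (γ, σ, ν), σ > 0, and let f : ℝ → ℝ be Borel with 𝔼|f(X_T)|^q < ∞ for some q > 1. Then 𝔼|f(x + X_{T-t})| < ∞ for all (t,x) ∈ [0,T] × ℝ, the function x ↦ F(t,x) := 𝔼 f(x + X_{T-t}) is C^∞ on ℝ for every t ∈ [0,T), and for any 0 ≤ s < t < T, 𝔼[∂_x F(t, X_t) | ℱ_s] = ∂_x F(s, X_s) almost surely. -/

import Mathlib

open MeasureTheory Filter ProbabilityTheory

/-- A Lévy measure on `ℝ`. -/
def IsLevyMeasure (ν : Measure ℝ) : Prop :=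
  ν {0} = 0 ∧ ∫⁻ x, ENNReal.ofReal (min (x ^ 2) 1) ∂ν < ⊤

/-- The Lévy–Khintchine exponent `ψ` associated with a triplet `(γ, σ, ν)`. -/
noncomputable def levyExponent (γ σ : ℝ) (ν : Measure ℝ) (u : ℝ) : ℂ :=
  -Complex.I * γ * u + σ ^ 2 * u ^ 2 / 2 -
    ∫ x, (Complex.exp (Complex.I * u * x) - 1 -
      Complex.I * u * ({y : ℝ | |y| ≤ 1}.indicator (fun y => (y : ℂ)) x)) ∂ν

/-- `X` is a Lévy process with triplet `(γ, σ, ν)` w.r.t. the filtration `ℱ` under `μ`: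
adapted, starting at `0`, càdlàg, with increments independent of the past and stationary,
whose one-dimensional distributions are given by the Lévy–Khintchine formula. -/
def IsLevyProcess {Ω : Type*} {m0 : MeasurableSpace Ω} (μ : Measure Ω)
    (ℱ : Filtration ℝ m0) (X : ℝ → Ω → ℝ) (γ σ : ℝ) (ν : Measure ℝ) : Prop :=
  Adapted ℱ X ∧
  (∀ ω, X 0 ω = 0) ∧
  (∀ ω t, ContinuousWithinAt (fun s => X s ω) (Set.Ici t) t) ∧
  (∀ s t : ℝ, 0 ≤ s → s ≤ t →
    ProbabilityTheory.Indep
      (MeasurableSpace.comap (fun ω => X t ω - X s ω) (inferInstance : MeasurableSpace ℝ))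
      (ℱ s) μ) ∧
  (∀ s t : ℝ, 0 ≤ s → s ≤ t →
    Measure.map (fun ω => X t ω - X s ω) μ = Measure.map (X (t - s)) μ) ∧
  (∀ t : ℝ, 0 ≤ t → ∀ u : ℝ,
    ∫ ω, Complex.exp (Complex.I * u * X t ω) ∂μ
      = Complex.exp (-(t : ℂ) * levyExponent γ σ ν u))


open scoped Topology

theorem exists_isProbabilityMeasure_charFun_eq_of_tendsto {m : ℕ → Measure ℝ}
    [∀ n, IsProbabilityMeasure (m n)] {φ : ℝ → ℂ} (hφ : ContinuousAt φ 0)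
    (h : ∀ u, Tendsto (fun n => charFun (m n) u) atTop (𝓝 (φ u))) :
    ∃ m₀ : Measure ℝ, IsProbabilityMeasure m₀ ∧ ∀ u, charFun m₀ u = φ u := by
  let p : ℕ → ProbabilityMeasure ℝ := fun n => ⟨m n, inferInstance⟩
  have hp : {((P : ProbabilityMeasure ℝ) : Measure ℝ) | P ∈ Set.range p} = Set.range m := by
    ext x
    constructor
    · rintro ⟨_, ⟨n, rfl⟩, rfl⟩
      exact ⟨n, rfl⟩
    · rintro ⟨n, rfl⟩
      exact ⟨_, ⟨n, rfl⟩, rfl⟩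
  have hcomp : IsCompact (closure (Set.range p)) :=
    isCompact_closure_of_isTightMeasureSet
      (hp ▸ isTightMeasureSet_of_tendsto_charFun hφ h)
  obtain ⟨P, -, hP⟩ := hcomp.exists_mapClusterPt (f := atTop) (u := p)
    (le_principal_iff.2 (mem_map.2 (Eventually.of_forall fun n => subset_closure ⟨n, rfl⟩)))
  refine ⟨P, inferInstance, fun u => ?_⟩
  have hc : Continuous fun Q : ProbabilityMeasure ℝ => charFun (Q : Measure ℝ) u := by
    refine continuous_iff_continuousAt.2 fun Q => ?_
    have := (ProbabilityMeasure.tendsto_iff_forall_integral_rclike_tendsto ℂ).1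
      (tendsto_id (α := ProbabilityMeasure ℝ) (x := 𝓝 Q))
    simp_rw [ContinuousAt, charFun_eq_integral_innerProbChar]
    exact this (BoundedContinuousFunction.innerProbChar u)
  have h1 := hP.continuousAt_comp hc.continuousAt
  have h2 : MapClusterPt (charFun (P : Measure ℝ) u) atTop fun n => charFun (m n) u := h1
  exact eq_of_nhds_neBot (ClusterPt.mono h2 (h u))

noncomputable def convPow (ρ : Measure ℝ) : ℕ → Measure ℝ
  | 0 => Measure.dirac 0
  | n + 1 => convPow ρ n ∗ ρ

instance (ρ : Measure ℝ) [IsFiniteMeasure ρ] (n : ℕ) : IsFiniteMeasure (convPow ρ n) := by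
  induction n with
  | zero => rw [convPow]; infer_instance
  | succ n ih => rw [convPow]; infer_instance

theorem charFun_convPow (ρ : Measure ℝ) [IsFiniteMeasure ρ] (n : ℕ) (u : ℝ) :
    charFun (convPow ρ n) u = charFun ρ u ^ n := by
  induction n with
  | zero => simp [convPow, charFun_dirac]
  | succ n ih => rw [convPow, charFun_conv, ih, pow_succ]

theorem convPow_univ (ρ : Measure ℝ) [IsFiniteMeasure ρ] (n : ℕ) :
    (convPow ρ n) Set.univ = ρ Set.univ ^ n := by
  induction n with
  | zero => simp [convPow]
  | succ n ih =>
    rw [convPow, pow_succ, ← ih, Measure.conv, Measure.map_apply (by fun_prop) .univ,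
      Set.preimage_univ, Measure.prod_apply .univ]
    simp [mul_comm]

theorem exists_isProbabilityMeasure_charFun_eq_compoundPoisson (ρ : Measure ℝ)
    [IsFiniteMeasure ρ] :
    ∃ m : Measure ℝ, IsProbabilityMeasure m ∧
      ∀ u, charFun m u = Complex.exp (charFun ρ u - ρ.real Set.univ) := by
  set r := ρ.real Set.univ
  have hr : 0 ≤ r := measureReal_nonneg
  let c : ℕ → ℝ := fun n => Real.exp (-r) / n.factorial
  have hc : ∀ n, 0 ≤ c n := fun n => by positivity
  let m : Measure ℝ := Measure.sum fun n => ENNReal.ofReal (c n) • convPow ρ n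
  have hs : Summable fun n => c n * r ^ n := by
    refine ((Real.summable_pow_div_factorial r).mul_left (Real.exp (-r))).congr fun n => ?_
    simp only [c]; ring
  have hfin : IsFiniteMeasure m := by
    constructor
    have h1 : ∀ n, (ENNReal.ofReal (c n) • convPow ρ n) Set.univ
        = ENNReal.ofReal (c n * r ^ n) := fun n => by
      rw [Measure.smul_apply, convPow_univ, smul_eq_mul, ENNReal.ofReal_mul (hc n),
        ENNReal.ofReal_pow hr, ofReal_measureReal]
    rw [Measure.sum_apply _ .univ]
    simp_rw [h1]
    rw [← ENNReal.ofReal_tsum_of_nonneg (fun n => mul_nonneg (hc n) (pow_nonneg hr n)) hs]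
    exact ENNReal.ofReal_lt_top
  have hchar : ∀ u, charFun m u = Complex.exp (charFun ρ u - r) := by
    intro u
    rw [charFun_apply_real, integral_sum_measure]
    · simp_rw [integral_smul_measure, ← charFun_apply_real, charFun_convPow,
        ENNReal.toReal_ofReal (hc _)]
      have hexp : Complex.exp (charFun ρ u) = ∑' n : ℕ, charFun ρ u ^ n / n.factorial := by
        rw [Complex.exp_eq_exp_ℂ, NormedSpace.exp_eq_tsum_div]
      rw [sub_eq_neg_add, Complex.exp_add, hexp, ← tsum_mul_left]
      congr 1 with n
      simp only [c, Complex.real_smul]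
      push_cast
      ring
    · refine (integrable_const (1 : ℝ)).mono' (by fun_prop) (ae_of_all _ fun x => ?_)
      rw [← Complex.ofReal_mul, Complex.norm_exp_ofReal_mul_I]
  refine ⟨m, ⟨?_⟩, hchar⟩
  have h0 := hchar 0
  rw [charFun_zero, charFun_zero, sub_self, Complex.exp_zero] at h0
  rw [← ofReal_measureReal (measure_ne_top _ _)]
  norm_cast at h0
  simp [h0]

theorem norm_exp_sub_one_sub_le (u x : ℝ) :
    ‖Complex.exp (Complex.I * u * x) - 1 -
      Complex.I * u * ({y : ℝ | |y| ≤ 1}.indicator (fun y => (y : ℂ)) x)‖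
      ≤ (2 + 3 * u ^ 2) * min (x ^ 2) 1 := by
  have hexp : ‖Complex.exp (Complex.I * u * x)‖ = 1 := by
    rw [show Complex.I * u * x = ((u * x : ℝ) : ℂ) * Complex.I by push_cast; ring,
      Complex.norm_exp_ofReal_mul_I]
  have h2 : ‖Complex.exp (Complex.I * u * x) - 1‖ ≤ 2 := by
    refine (norm_sub_le _ _).trans ?_
    rw [hexp, norm_one]; norm_num
  by_cases hx : |x| ≤ 1
  · have hx2 : x ^ 2 ≤ 1 := by rwa [sq_le_one_iff_abs_le_one]
    rw [min_eq_left hx2, Set.indicator_of_mem (s := {y : ℝ | |y| ≤ 1}) hx]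
    have hn : ‖Complex.I * u * x‖ = |u * x| := by
      simp [abs_mul]
    by_cases hux : |u * x| ≤ 1
    · refine (Complex.norm_exp_sub_one_sub_id_le (hn ▸ hux)).trans ?_
      rw [hn, sq_abs]
      nlinarith [sq_nonneg (u * x), sq_nonneg x]
    · refine (norm_sub_le _ _).trans ?_
      rw [hn]
      have : |u * x| ^ 2 = u ^ 2 * x ^ 2 := by rw [sq_abs]; ring
      nlinarith [sq_nonneg x]
  · have hx2 : 1 ≤ x ^ 2 := by
      rw [one_le_sq_iff_one_le_abs]; exact (not_le.1 hx).le
    rw [min_eq_right hx2, Set.indicator_of_notMem (by exact hx), mul_zero, sub_zero]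
    nlinarith [sq_nonneg u]


theorem measurable_levyIntegrand (u : ℝ) :
    Measurable fun x : ℝ => Complex.exp (Complex.I * u * x) - 1 -
      Complex.I * u * ({y : ℝ | |y| ≤ 1}.indicator (fun y => (y : ℂ)) x) := by
  have hS : MeasurableSet {y : ℝ | |y| ≤ 1} := measurableSet_le (by fun_prop) (by fun_prop)
  have := (Complex.measurable_ofReal.indicator hS)
  fun_prop

theorem IsLevyMeasure.integrable_min {ν : Measure ℝ} (hν : IsLevyMeasure ν) :
    Integrable (fun x : ℝ => min (x ^ 2) 1) ν := by
  refine ⟨by fun_prop, ?_⟩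
  rw [hasFiniteIntegral_iff_ofReal (ae_of_all _ fun x => by positivity)]
  exact hν.2

theorem IsLevyMeasure.integrable_levyIntegrand {ν : Measure ℝ} (hν : IsLevyMeasure ν) (u : ℝ) :
    Integrable (fun x : ℝ => Complex.exp (Complex.I * u * x) - 1 -
      Complex.I * u * ({y : ℝ | |y| ≤ 1}.indicator (fun y => (y : ℂ)) x)) ν :=
  (hν.integrable_min.const_mul (2 + 3 * u ^ 2)).mono'
    (measurable_levyIntegrand u).aestronglyMeasurable
    (ae_of_all _ fun x => norm_exp_sub_one_sub_le u x)

theorem IsLevyMeasure.measure_lt_abs_lt_top {ν : Measure ℝ} (hν : IsLevyMeasure ν) {ε : ℝ}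
    (hε : 0 < ε) : ν {x | ε < |x|} < ⊤ := by
  have hpos : 0 < min (ε ^ 2) 1 := by positivity
  refine (measure_mono fun x hx => ?_).trans_lt
    (hν.integrable_min.measure_ge_lt_top hpos)
  have : ε ^ 2 ≤ x ^ 2 := by rw [← sq_abs x]; exact pow_le_pow_left₀ hε.le (le_of_lt hx) 2
  exact min_le_min_right 1 this

/-- The truncation of a Lévy measure away from the origin yields a compound Poisson law with
drift. -/
theorem IsLevyMeasure.exists_charFun_eq_of_truncation {ν : Measure ℝ} (hν : IsLevyMeasure ν)
    (γ τ : ℝ) (hτ : 0 ≤ τ) {ε : ℝ} (hε : 0 < ε) :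
    ∃ m : Measure ℝ, IsProbabilityMeasure m ∧ ∀ u : ℝ, charFun m u =
      Complex.exp (τ * (Complex.I * γ * u + ∫ x in {x | ε < |x|},
        (Complex.exp (Complex.I * u * x) - 1 -
          Complex.I * u * ({y : ℝ | |y| ≤ 1}.indicator (fun y => (y : ℂ)) x)) ∂ν)) := by
  set S : Set ℝ := {x | ε < |x|}
  have hfin : IsFiniteMeasure (ν.restrict S) :=
    ⟨by rw [Measure.restrict_apply_univ]; exact hν.measure_lt_abs_lt_top hε⟩
  let ρ : Measure ℝ := τ.toNNReal • ν.restrict S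
  obtain ⟨m, hm, hmc⟩ := exists_isProbabilityMeasure_charFun_eq_compoundPoisson ρ
  let b : ℝ := ∫ x in S, {y : ℝ | |y| ≤ 1}.indicator (fun y => y) x ∂ν
  have hB : MeasurableSet {y : ℝ | |y| ≤ 1} := measurableSet_le (by fun_prop) (by fun_prop)
  refine ⟨m ∗ Measure.dirac (τ * (γ - b)), inferInstance, fun u => ?_⟩
  have hind : ∀ x : ℝ, {y : ℝ | |y| ≤ 1}.indicator (fun y => (y : ℂ)) x
      = (({y : ℝ | |y| ≤ 1}.indicator (fun y => y) x : ℝ) : ℂ) := fun x => by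
    by_cases hx : x ∈ {y : ℝ | |y| ≤ 1} <;> simp [hx]
  have hbi : Integrable (fun x : ℝ => {y : ℝ | |y| ≤ 1}.indicator (fun y => y) x)
      (ν.restrict S) := by
    refine (integrable_const (1 : ℝ)).mono'
      (measurable_id.indicator hB).aestronglyMeasurable (ae_of_all _ fun x => ?_)
    by_cases hx : x ∈ {y : ℝ | |y| ≤ 1}
    · rw [Set.indicator_of_mem hx]; exact hx
    · simp [hx]
  have hexp : Integrable (fun x : ℝ => Complex.exp (Complex.I * u * x)) (ν.restrict S) := by
    refine (integrable_const (1 : ℝ)).mono' (by fun_prop) (ae_of_all _ fun x => ?_)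
    rw [show Complex.I * u * x = ((u * x : ℝ) : ℂ) * Complex.I by push_cast; ring,
      Complex.norm_exp_ofReal_mul_I]
  rw [charFun_conv, hmc, charFun_dirac, ← Complex.exp_add]
  congr 1
  have key : ∫ x in S, (Complex.exp (Complex.I * u * x) - 1 -
          Complex.I * u * ({y : ℝ | |y| ≤ 1}.indicator (fun y => (y : ℂ)) x)) ∂ν
      = (∫ x in S, Complex.exp (Complex.I * u * x) ∂ν) - ν.real S - Complex.I * u * b := by
    have hbi' : Integrable (fun x : ℝ => Complex.I * u *
        (({y : ℝ | |y| ≤ 1}.indicator (fun y => y) x : ℝ) : ℂ)) (ν.restrict S) :=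
      hbi.ofReal.const_mul _
    simp_rw [hind]
    rw [integral_sub (f := fun x : ℝ => Complex.exp (Complex.I * u * x) - 1)
      (hexp.sub (integrable_const _)) hbi',
      integral_sub hexp (integrable_const _), integral_const_mul, integral_complex_ofReal]
    simp [b]
  have hρ : charFun ρ u = τ * ∫ x in S, Complex.exp (Complex.I * u * x) ∂ν := by
    rw [charFun_apply_real]
    simp only [ρ]
    rw [integral_smul_nnreal_measure, NNReal.smul_def, Real.coe_toNNReal _ hτ, Complex.real_smul]
    congr 2 with x
    ring_nf
  have hρu : ρ.real Set.univ = τ * ν.real S := by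
    simp [ρ, hτ]
  rw [hρ, key, hρu]
  simp
  ring

/-- The exponential of the non-Gaussian part of the Lévy exponent is a characteristic function
as soon as it is continuous at the origin. -/
theorem IsLevyMeasure.exists_charFun_eq {ν : Measure ℝ} (hν : IsLevyMeasure ν)
    (γ σ τ : ℝ) (hτ : 0 ≤ τ) {φ : ℝ → ℂ} (hφ : ContinuousAt φ 0)
    (h : ∀ u : ℝ, φ u = Complex.exp (-τ * levyExponent γ σ ν u + σ ^ 2 * τ * u ^ 2 / 2)) :
    ∃ m : Measure ℝ, IsProbabilityMeasure m ∧ ∀ u : ℝ, charFun m u = φ u := by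
  have hpos : ∀ n : ℕ, (0 : ℝ) < 1 / (n + 1) := fun n => Nat.one_div_pos_of_nat
  choose m hm hmc using fun n : ℕ => hν.exists_charFun_eq_of_truncation γ τ hτ (hpos n)
  refine exists_isProbabilityMeasure_charFun_eq_of_tendsto (m := m) hφ fun u => ?_
  simp_rw [hmc, h]
  set k : ℝ → ℂ := fun x => Complex.exp (Complex.I * u * x) - 1 -
    Complex.I * u * ({y : ℝ | |y| ≤ 1}.indicator (fun y => (y : ℂ)) x) with hk
  have hunion : ⋃ n : ℕ, {x : ℝ | 1 / ((n : ℝ) + 1) < |x|} = {0}ᶜ := by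
    ext x
    simp only [Set.mem_iUnion, Set.mem_ofPred_eq, Set.mem_compl_iff, Set.mem_singleton_iff]
    refine ⟨fun ⟨n, hn⟩ h0 => ?_, fun hx => exists_nat_one_div_lt (abs_pos.2 hx)⟩
    rw [h0, abs_zero] at hn
    exact (hpos n).not_gt hn
  have hlim := tendsto_setIntegral_of_monotone (μ := ν) (f := k)
    (s := fun n : ℕ => {x : ℝ | 1 / ((n : ℝ) + 1) < |x|})
    (fun n => measurableSet_lt (by fun_prop) (by fun_prop))
    (fun n n' hn x hx => (Nat.one_div_le_one_div (α := ℝ) hn).trans_lt hx)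
    (hν.integrable_levyIntegrand u).integrableOn
  rw [hunion, setIntegral_eq_integral_of_forall_compl_eq_zero (fun x hx => by
    have : x = 0 := by simpa using hx
    simp [hk, this])] at hlim
  have hval : -τ * levyExponent γ σ ν u + σ ^ 2 * τ * u ^ 2 / 2
      = τ * (Complex.I * γ * u + ∫ x, k x ∂ν) := by
    rw [levyExponent]; ring
  rw [hval]
  exact (Complex.continuous_exp.tendsto _).comp ((hlim.const_add _).const_mul _)

theorem charFun_map_eq_of_isLevyProcess {Ω : Type*} {m0 : MeasurableSpace Ω} {μ : Measure Ω}
    {ℱ : Filtration ℝ m0} {X : ℝ → Ω → ℝ} {γ σ : ℝ} {ν : Measure ℝ}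
    (hX : IsLevyProcess μ ℱ X γ σ ν) {τ : ℝ} (hτ : 0 ≤ τ) (u : ℝ) :
    charFun (μ.map (X τ)) u = Complex.exp (-τ * levyExponent γ σ ν u) := by
  have hm : Measurable (X τ) := (hX.1 τ).mono (ℱ.le τ) le_rfl
  rw [charFun_apply_real, integral_map hm.aemeasurable (by fun_prop), ← hX.2.2.2.2.2 τ hτ u]
  congr 1 with ω
  ring_nf

theorem map_eq_conv_of_isLevyProcess {Ω : Type*} {m0 : MeasurableSpace Ω} {μ : Measure Ω}
    [IsProbabilityMeasure μ]
    {ℱ : Filtration ℝ m0} {X : ℝ → Ω → ℝ} {γ σ : ℝ} {ν : Measure ℝ}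
    (hX : IsLevyProcess μ ℱ X γ σ ν) {s t : ℝ} (hs : 0 ≤ s) (ht : 0 ≤ t) :
    μ.map (X (s + t)) = μ.map (X s) ∗ μ.map (X t) := by
  refine Measure.ext_of_charFun (funext fun u => ?_)
  rw [charFun_conv, charFun_map_eq_of_isLevyProcess hX hs, charFun_map_eq_of_isLevyProcess hX ht,
    charFun_map_eq_of_isLevyProcess hX (add_nonneg hs ht), ← Complex.exp_add]
  congr 1
  push_cast
  ring

theorem exists_map_eq_gaussianReal_conv_of_isLevyProcess {Ω : Type*} {m0 : MeasurableSpace Ω}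
    {μ : Measure Ω} [IsProbabilityMeasure μ]
    {ℱ : Filtration ℝ m0} {X : ℝ → Ω → ℝ} {γ σ : ℝ} {ν : Measure ℝ} (hν : IsLevyMeasure ν)
    (hX : IsLevyProcess μ ℱ X γ σ ν) {τ : ℝ} (hτ : 0 ≤ τ) :
    ∃ m : Measure ℝ, IsProbabilityMeasure m ∧
      μ.map (X τ) = gaussianReal 0 (σ ^ 2 * τ).toNNReal ∗ m := by
  have hc : Continuous fun u : ℝ =>
      charFun (μ.map (X τ)) u * Complex.exp (σ ^ 2 * τ * u ^ 2 / 2) := by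
    fun_prop
  obtain ⟨m, hm, hmc⟩ := hν.exists_charFun_eq γ σ τ hτ (hc.continuousAt (x := 0)) fun u => by
    rw [charFun_map_eq_of_isLevyProcess hX hτ, ← Complex.exp_add]
  refine ⟨m, hm, Measure.ext_of_charFun (funext fun u => ?_)⟩
  rw [charFun_conv, hmc, charFun_gaussianReal, mul_left_comm, ← Complex.exp_add,
    Real.coe_toNNReal _ (by positivity)]
  simp

section MgfWeighted

variable {Ω : Type*} {m0 : MeasurableSpace Ω} {P : Measure Ω} {Y : Ω → ℝ} {h : Ω → ℝ}

theorem weighted_mgf_of_nnreal {k : Ω → NNReal} (hk : Measurable k)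
    (hint : ∀ c : ℝ, Integrable (fun ω => Real.exp (c * Y ω) * k ω) P) :
    ContDiff ℝ (⊤ : ℕ∞) (fun c => ∫ ω, Real.exp (c * Y ω) * k ω ∂P) ∧
    ∀ c : ℝ, Integrable (fun ω => Y ω * Real.exp (c * Y ω) * k ω) P ∧
      HasDerivAt (fun c => ∫ ω, Real.exp (c * Y ω) * k ω ∂P)
        (∫ ω, Y ω * Real.exp (c * Y ω) * k ω ∂P) c := by
  set κ : Measure Ω := P.withDensity fun ω => (k ω : ENNReal)
  have hI (g : Ω → ℝ) : ∫ ω, g ω ∂κ = ∫ ω, g ω * k ω ∂P := by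
    rw [integral_withDensity_eq_integral_smul hk]
    simp [NNReal.smul_def, mul_comm]
  have hJ (g : Ω → ℝ) : Integrable g κ ↔ Integrable (fun ω => g ω * k ω) P := by
    rw [integrable_withDensity_iff_integrable_smul hk]
    simp [NNReal.smul_def, mul_comm]
  have huniv : integrableExpSet Y κ = Set.univ :=
    Set.eq_univ_of_forall fun c => (hJ _).2 (hint c)
  have hmem : ∀ c : ℝ, c ∈ interior (integrableExpSet Y κ) := by simp [huniv]
  have hmgf : (fun c => ∫ ω, Real.exp (c * Y ω) * k ω ∂P) = mgf Y κ := by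
    ext c; rw [mgf, hI]
  rw [hmgf]
  refine ⟨contDiff_iff_contDiffAt.2 fun c => (analyticAt_mgf (hmem c)).contDiffAt, fun c => ?_⟩
  have h1 := integrable_pow_mul_exp_of_mem_interior_integrableExpSet (hmem c) 1
  simp only [pow_one] at h1
  refine ⟨(hJ _).1 h1, ?_⟩
  rw [← hI]
  exact hasDerivAt_mgf (hmem c)

/-- A Laplace transform weighted by a signed function is smooth and can be differentiated under
the integral sign as soon as it converges absolutely everywhere. -/
theorem contDiff_and_hasDerivAt_integral_exp_mul (hh : Measurable h)
    (hint : ∀ c : ℝ, Integrable (fun ω => Real.exp (c * Y ω) * h ω) P) :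
    ContDiff ℝ (⊤ : ℕ∞) (fun c => ∫ ω, Real.exp (c * Y ω) * h ω ∂P) ∧
    ∀ c : ℝ, Integrable (fun ω => Y ω * Real.exp (c * Y ω) * h ω) P ∧
      HasDerivAt (fun c => ∫ ω, Real.exp (c * Y ω) * h ω ∂P)
        (∫ ω, Y ω * Real.exp (c * Y ω) * h ω ∂P) c := by
  have hpos : Measurable fun ω => (h ω).toNNReal := by fun_prop
  have hneg : Measurable fun ω => (-h ω).toNNReal := by fun_prop
  have hsub (a : ℝ) (ω : Ω) :
      a * h ω = a * (h ω).toNNReal - a * (-h ω).toNNReal := by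
    rw [Real.coe_toNNReal', Real.coe_toNNReal', ← mul_sub, max_zero_sub_max_neg_zero_eq_self]
  have hp : ∀ c : ℝ, Integrable (fun ω => Real.exp (c * Y ω) * (h ω).toNNReal) P := fun c => by
    refine (hint c).pos_part.congr (ae_of_all _ fun ω => ?_)
    simp [Real.coe_toNNReal', mul_max_of_nonneg _ _ (Real.exp_nonneg _)]
  have hn : ∀ c : ℝ, Integrable (fun ω => Real.exp (c * Y ω) * (-h ω).toNNReal) P := fun c => by
    refine (hint c).neg_part.congr (ae_of_all _ fun ω => ?_)
    simp [Real.coe_toNNReal', mul_max_of_nonneg _ _ (Real.exp_nonneg _)]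
  obtain ⟨hp1, hp2⟩ := weighted_mgf_of_nnreal hpos hp
  obtain ⟨hn1, hn2⟩ := weighted_mgf_of_nnreal hneg hn
  have heq : (fun c => ∫ ω, Real.exp (c * Y ω) * h ω ∂P) = fun c =>
      (∫ ω, Real.exp (c * Y ω) * (h ω).toNNReal ∂P)
        - ∫ ω, Real.exp (c * Y ω) * (-h ω).toNNReal ∂P := by
    ext c
    rw [← integral_sub (hp c) (hn c)]
    exact integral_congr_ae (ae_of_all _ fun ω => hsub _ ω)
  rw [heq]
  refine ⟨hp1.sub hn1, fun c => ?_⟩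
  simp_rw [hsub]
  refine ⟨(hp2 c).1.sub (hn2 c).1, ?_⟩
  rw [integral_sub (hp2 c).1 (hn2 c).1]
  exact (hp2 c).2.sub (hn2 c).2

end MgfWeighted

section GaussianSmoothing

variable {v : NNReal} {m : Measure ℝ} [IsProbabilityMeasure m]

theorem gaussianReal_eq_withDensity (hv : v ≠ 0) (x : ℝ) :
    gaussianReal x v = (gaussianReal 0 v).withDensity
      fun g => ENNReal.ofReal (Real.exp (x / v * g - x ^ 2 / (2 * v))) := by
  have hv' : (v : ℝ) ≠ 0 := by exact_mod_cast hv
  rw [gaussianReal_of_var_ne_zero _ hv, gaussianReal_of_var_ne_zero _ hv,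
    ← withDensity_mul _ (by fun_prop) (by fun_prop)]
  congr 1 with g
  rw [Pi.mul_apply, gaussianPDF, gaussianPDF, ← ENNReal.ofReal_mul (gaussianPDFReal_nonneg _ _ _),
    gaussianPDFReal, gaussianPDFReal, mul_assoc _ (Real.exp _) (Real.exp _), ← Real.exp_add]
  congr 3
  field_simp
  ring

theorem map_shift_gaussianReal_prod (hv : v ≠ 0) (x : ℝ) :
    ((gaussianReal 0 v).prod m).map (Prod.map (x + ·) id)
      = ((gaussianReal 0 v).prod m).withDensity
        fun p => ((Real.exp (x / v * p.1 - x ^ 2 / (2 * v))).toNNReal : ENNReal) := by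
  rw [← Measure.map_prod_map _ _ (by fun_prop) measurable_id, gaussianReal_map_const_add,
    Measure.map_id, zero_add, gaussianReal_eq_withDensity hv, prod_withDensity_left (by fun_prop)]
  rfl

theorem integrable_shift_gaussianReal_prod_iff (hv : v ≠ 0) (x : ℝ) {H : ℝ × ℝ → ℝ}
    (hH : Measurable H) :
    Integrable (fun p => H (x + p.1, p.2)) ((gaussianReal 0 v).prod m) ↔
      Integrable (fun p => Real.exp (x / v * p.1 - x ^ 2 / (2 * v)) * H p)
        ((gaussianReal 0 v).prod m) := by
  have h := integrable_map_measure (μ := (gaussianReal 0 v).prod m) (g := H)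
    (f := Prod.map (x + ·) id) hH.aestronglyMeasurable (by fun_prop)
  rw [map_shift_gaussianReal_prod hv,
    integrable_withDensity_iff_integrable_smul (by fun_prop)] at h
  simp only [NNReal.smul_def, Real.coe_toNNReal _ (Real.exp_nonneg _), smul_eq_mul] at h
  exact h.symm

theorem integral_shift_gaussianReal_prod (hv : v ≠ 0) (x : ℝ) {H : ℝ × ℝ → ℝ}
    (hH : Measurable H) :
    ∫ p, H (x + p.1, p.2) ∂(gaussianReal 0 v).prod m =
      ∫ p, Real.exp (x / v * p.1 - x ^ 2 / (2 * v)) * H p ∂(gaussianReal 0 v).prod m := by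
  have h := integral_map (μ := (gaussianReal 0 v).prod m) (f := H)
    (φ := Prod.map (x + ·) id) (by fun_prop) hH.aestronglyMeasurable
  rw [map_shift_gaussianReal_prod hv,
    integral_withDensity_eq_integral_smul (by fun_prop)] at h
  simp only [NNReal.smul_def, Real.coe_toNNReal _ (Real.exp_nonneg _), smul_eq_mul] at h
  exact h.symm

theorem memLp_of_integrable_abs_rpow {Ω : Type*} {m0 : MeasurableSpace Ω} {P : Measure Ω}
    {h : Ω → ℝ} (hh : AEStronglyMeasurable h P) {q : ℝ} (hq : 0 < q)
    (hint : Integrable (fun ω => |h ω| ^ q) P) : MemLp h (ENNReal.ofReal q) P := by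
  rw [← integrable_norm_rpow_iff hh (by simpa using hq) ENNReal.ofReal_ne_top,
    ENNReal.toReal_ofReal hq.le]
  exact hint

theorem integrable_exp_mul_of_memLp {h : ℝ × ℝ → ℝ} {q : ℝ} (hq : 1 < q)
    (hh : MemLp h (ENNReal.ofReal q) ((gaussianReal 0 v).prod m)) (c : ℝ) :
    Integrable (fun p => Real.exp (c * p.1) * h p) ((gaussianReal 0 v).prod m) := by
  have hqc := Real.HolderConjugate.conjExponent hq
  set q' := q.conjExponent
  have hq' : 0 < q' := hqc.symm.pos
  have hexp : MemLp (fun p : ℝ × ℝ => Real.exp (c * p.1)) (ENNReal.ofReal q')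
      ((gaussianReal 0 v).prod m) := by
    refine memLp_of_integrable_abs_rpow (by fun_prop) hq' ?_
    simp_rw [Real.abs_exp, ← Real.exp_mul]
    refine (((integrable_exp_mul_gaussianReal (μ := 0) (v := v) (c * q')).comp_fst m)).congr
      (ae_of_all _ fun p => ?_)
    ring_nf
  have : ENNReal.HolderConjugate (ENNReal.ofReal q') (ENNReal.ofReal q) := hqc.symm.ennrealOfReal
  exact hexp.integrable_mul hh

/-- Smoothing by a Gaussian component. -/
theorem gaussian_smoothing_of_origin (hv : v ≠ 0) {f : ℝ → ℝ} (hf : Measurable f) {q : ℝ}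
    (hq : 1 < q)
    (hfq : Integrable (fun p : ℝ × ℝ => |f (p.1 + p.2)| ^ q) ((gaussianReal 0 v).prod m)) :
    ContDiff ℝ (⊤ : ℕ∞) (fun x => ∫ p, f (x + (p.1 + p.2)) ∂(gaussianReal 0 v).prod m) ∧
    ∀ x, Integrable (fun p => f (x + (p.1 + p.2))) ((gaussianReal 0 v).prod m) ∧
      Integrable (fun p => p.1 * f (x + (p.1 + p.2))) ((gaussianReal 0 v).prod m) ∧
      HasDerivAt (fun x => ∫ p, f (x + (p.1 + p.2)) ∂(gaussianReal 0 v).prod m)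
        ((∫ p, p.1 * f (x + (p.1 + p.2)) ∂(gaussianReal 0 v).prod m) / v) x := by
  set P := (gaussianReal 0 v).prod m with hP
  have hv' : (v : ℝ) ≠ 0 := by exact_mod_cast hv
  have hmeas : Measurable fun p : ℝ × ℝ => f (p.1 + p.2) := by fun_prop
  have hmem := memLp_of_integrable_abs_rpow hmeas.aestronglyMeasurable (by linarith) hfq
  have hint := integrable_exp_mul_of_memLp hq hmem
  obtain ⟨hK, hK'⟩ := contDiff_and_hasDerivAt_integral_exp_mul hmeas hint
  set K : ℝ → ℝ := fun c => ∫ p, Real.exp (c * p.1) * f (p.1 + p.2) ∂P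
  have hexp (x g : ℝ) : Real.exp (x / v * g - x ^ 2 / (2 * v))
      = Real.exp (-(x ^ 2 / (2 * v))) * Real.exp (x / v * g) := by
    rw [← Real.exp_add]; ring_nf
  have hH : (fun x => ∫ p, f (x + (p.1 + p.2)) ∂P)
      = fun x => Real.exp (-(x ^ 2 / (2 * v))) * K (x / v) := by
    ext x
    simp_rw [← add_assoc]
    rw [integral_shift_gaussianReal_prod hv x hmeas, ← integral_const_mul]
    simp_rw [hexp, mul_assoc]
    rfl
  have hmeas1 (x : ℝ) : Measurable fun p : ℝ × ℝ => (p.1 - x) * f (p.1 + p.2) := by fun_prop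
  have hsplit (x : ℝ) (p : ℝ × ℝ) :
      Real.exp (x / v * p.1 - x ^ 2 / (2 * v)) * ((p.1 - x) * f (p.1 + p.2))
      = Real.exp (-(x ^ 2 / (2 * v))) * (p.1 * Real.exp (x / v * p.1) * f (p.1 + p.2)
        - x * (Real.exp (x / v * p.1) * f (p.1 + p.2))) := by
    rw [hexp]; ring
  have hshift (x : ℝ) : (fun p : ℝ × ℝ => p.1 * f (x + (p.1 + p.2)))
      = fun p => (fun p : ℝ × ℝ => (p.1 - x) * f (p.1 + p.2)) (x + p.1, p.2) := by
    ext p; simp [add_assoc]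
  refine ⟨?_, fun x => ⟨?_, ?_, ?_⟩⟩
  · rw [hH]
    have h1 : ContDiff ℝ (⊤ : ℕ∞) fun x : ℝ => K (x / v) := hK.comp (by fun_prop)
    exact ContDiff.mul (by fun_prop) h1
  · simp_rw [← add_assoc]
    rw [integrable_shift_gaussianReal_prod_iff hv x hmeas]
    simp_rw [hexp, mul_assoc]
    exact (hint _).const_mul _
  · rw [hshift, integrable_shift_gaussianReal_prod_iff hv x (hmeas1 x)]
    simp_rw [hsplit]
    exact ((hK' _).1.sub ((hint _).const_mul _)).const_mul _
  · rw [hshift, integral_shift_gaussianReal_prod hv x (hmeas1 x), hH]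
    simp_rw [hsplit]
    rw [integral_const_mul, integral_sub (hK' _).1 ((hint _).const_mul _), integral_const_mul]
    have h1 : HasDerivAt (K ∘ fun x : ℝ => x / v) (_ * (1 / (v : ℝ))) x :=
      (hK' (x / v)).2.comp x ((hasDerivAt_id' x).div_const (v : ℝ))
    have h2 : HasDerivAt (fun x : ℝ => -(x ^ 2 / (2 * (v : ℝ)))) (-(2 * x / (2 * v))) x := by
      simpa using (((hasDerivAt_pow 2 x).div_const (2 * (v : ℝ))).fun_neg)
    refine (h2.exp.mul h1).congr_deriv ?_
    simp only [Function.comp_apply, K, hP]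
    field_simp
    ring

/-- Smoothing by a Gaussian component, with the moment condition at an arbitrary point. -/
theorem gaussian_smoothing (hv : v ≠ 0) {f : ℝ → ℝ} (hf : Measurable f) {q : ℝ}
    (hq : 1 < q) {x₀ : ℝ}
    (hfq : Integrable (fun p : ℝ × ℝ => |f (x₀ + (p.1 + p.2))| ^ q) ((gaussianReal 0 v).prod m)) :
    ContDiff ℝ (⊤ : ℕ∞) (fun x => ∫ p, f (x + (p.1 + p.2)) ∂(gaussianReal 0 v).prod m) ∧
    ∀ x, Integrable (fun p => f (x + (p.1 + p.2))) ((gaussianReal 0 v).prod m) ∧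
      Integrable (fun p => p.1 * f (x + (p.1 + p.2))) ((gaussianReal 0 v).prod m) ∧
      HasDerivAt (fun x => ∫ p, f (x + (p.1 + p.2)) ∂(gaussianReal 0 v).prod m)
        ((∫ p, p.1 * f (x + (p.1 + p.2)) ∂(gaussianReal 0 v).prod m) / v) x := by
  have hf' : Measurable fun z => f (x₀ + z) := by fun_prop
  obtain ⟨h1, h2⟩ := gaussian_smoothing_of_origin hv hf' hq hfq
  have hx (x z : ℝ) : x₀ + (x - x₀ + z) = x + z := by ring
  refine ⟨?_, fun x => ?_⟩
  · have := h1.comp (contDiff_id.sub (contDiff_const (c := x₀)))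
    simpa only [Function.comp_def, id, hx] using this
  · obtain ⟨ha, hb, hc⟩ := h2 (x - x₀)
    simp only [hx] at ha hb hc
    refine ⟨ha, hb, ?_⟩
    have := hc.comp_sub_const x x₀
    simpa only [hx] using this

end GaussianSmoothing

theorem condExp_comp_add_of_indep {Ω : Type*} {𝓖 m0 : MeasurableSpace Ω} {μ : Measure Ω}
    [IsProbabilityMeasure μ] (h𝓖 : 𝓖 ≤ m0) {U D : Ω → ℝ} (hU : Measurable[𝓖] U)
    (hD : Measurable D) (hind : Indep (MeasurableSpace.comap D inferInstance) 𝓖 μ)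
    {φ : ℝ → ℝ} (hφ : Measurable φ) (hint : Integrable (fun ω => φ (U ω + D ω)) μ) :
    μ[fun ω => φ (U ω + D ω)|𝓖] =ᵐ[μ] fun ω => ∫ y, φ (U ω + y) ∂μ.map D := by
  have : IsProbabilityMeasure (μ.map D) := Measure.isProbabilityMeasure_map hD.aemeasurable
  have hG : StronglyMeasurable fun x => ∫ y, φ (x + y) ∂μ.map D :=
    StronglyMeasurable.integral_prod_right
      (f := fun x y => φ (x + y)) (by fun_prop : Measurable _).stronglyMeasurable
  have key (A : Set Ω) (hA : MeasurableSet[𝓖] A) :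
      Integrable (fun ω => A.indicator 1 ω * ∫ y, φ (U ω + y) ∂μ.map D) μ ∧
      ∫ ω, A.indicator 1 ω * φ (U ω + D ω) ∂μ
        = ∫ ω, A.indicator 1 ω * ∫ y, φ (U ω + y) ∂μ.map D ∂μ := by
    let V : Ω → ℝ × ℝ := fun ω => (U ω, A.indicator 1 ω)
    have hone : Measurable[𝓖] (1 : Ω → ℝ) := @measurable_const _ _ _ 𝓖 1
    have hV : Measurable[𝓖] V := hU.prodMk (hone.indicator hA)
    have hV' : Measurable V := hV.mono h𝓖 le_rfl
    have hVD : IndepFun V D μ := (indep_of_indep_of_le_right hind hV.comap_le).symm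
    have hprod := (indepFun_iff_map_prod_eq_prod_map_map hV'.aemeasurable hD.aemeasurable).1 hVD
    let H : (ℝ × ℝ) × ℝ → ℝ := fun p => p.1.2 * φ (p.1.1 + p.2)
    have hH : Measurable H := by fun_prop
    have hHint : Integrable (fun ω => H (V ω, D ω)) μ := by
      refine (hint.indicator (h𝓖 _ hA)).congr (ae_of_all _ fun ω => ?_)
      by_cases hω : ω ∈ A <;> simp [H, V, hω]
    have hHint' : Integrable H ((μ.map V).prod (μ.map D)) := by
      rw [← hprod, integrable_map_measure hH.aestronglyMeasurable (by fun_prop)]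
      exact hHint
    have h1 := hHint'.integral_prod_left
    rw [integrable_map_measure h1.1 hV'.aemeasurable] at h1
    have h2 : ∫ ω, H (V ω, D ω) ∂μ = ∫ ω, ∫ y, H (V ω, y) ∂μ.map D ∂μ := by
      rw [← integral_map (φ := fun ω => (V ω, D ω)) (by fun_prop) hH.aestronglyMeasurable, hprod,
        integral_prod _ hHint', integral_map hV'.aemeasurable
          (hHint'.integral_prod_left).1]
    simp only [Function.comp_def, H, V, integral_const_mul] at h1 h2
    exact ⟨h1, h2⟩
  have hind' (A : Set Ω) (hA : MeasurableSet[𝓖] A) (g : Ω → ℝ) :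
      ∫ ω in A, g ω ∂μ = ∫ ω, A.indicator 1 ω * g ω ∂μ := by
    rw [← integral_indicator (h𝓖 _ hA)]
    refine integral_congr_ae (ae_of_all _ fun ω => ?_)
    by_cases hω : ω ∈ A <;> simp [hω]
  refine (ae_eq_condExp_of_forall_setIntegral_eq h𝓖 hint (fun A hA _ => ?_) (fun A hA _ => ?_)
    (hG.comp_measurable hU).aestronglyMeasurable).symm
  · have := (key Set.univ MeasurableSet.univ).1
    simp only [Set.indicator_univ, Pi.one_apply, one_mul] at this
    exact this.integrableOn
  · rw [hind' A hA, hind' A hA, (key A hA).2]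
    rfl

theorem integrable_comp_add_conv_iff {ρ κ : Measure ℝ} {f : ℝ → ℝ} (hf : Measurable f)
    (x : ℝ) :
    Integrable (fun y => f (x + y)) (ρ ∗ κ) ↔
      Integrable (fun p => f (x + (p.1 + p.2))) (ρ.prod κ) :=
  integrable_map_measure (hf.comp (measurable_const_add x)).aestronglyMeasurable (by fun_prop)

theorem integral_comp_add_conv {ρ κ : Measure ℝ} {f : ℝ → ℝ} (hf : Measurable f) (x : ℝ) :
    ∫ y, f (x + y) ∂(ρ ∗ κ) = ∫ p, f (x + (p.1 + p.2)) ∂ρ.prod κ :=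
  integral_map (by fun_prop) (hf.comp (measurable_const_add x)).aestronglyMeasurable

section Semigroup

variable {ρ κ m : Measure ℝ} [IsProbabilityMeasure ρ] [IsProbabilityMeasure κ]
  [IsProbabilityMeasure m] {v : NNReal}

theorem exists_integrable_comp_add_of_conv {f : ℝ → ℝ} (hf : Measurable f)
    (h : Integrable f (ρ ∗ κ)) : ∃ x₀, Integrable (fun y => f (x₀ + y)) κ :=
  ((integrable_conv_iff hf.aestronglyMeasurable).1 h).1.exists

theorem measurePreserving_prod_conv :
    MeasurePreserving (fun p : ℝ × ℝ × ℝ => (p.2.1, p.1 + p.2.2)) (ρ.prod (κ.prod m))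
      (κ.prod (ρ ∗ m)) := by
  have h1 := (measurePreserving_prodAssoc ρ κ m).symm
  have h2 := (Measure.measurePreserving_swap (μ := ρ) (ν := κ)).prod (MeasurePreserving.id m)
  have h3 := measurePreserving_prodAssoc κ ρ m
  have h4 : MeasurePreserving (fun p : ℝ × ℝ => p.1 + p.2) (ρ.prod m) (ρ ∗ m) :=
    ⟨by fun_prop, rfl⟩
  exact ((MeasurePreserving.id κ).prod h4).comp (h3.comp (h2.comp h1))

variable {f : ℝ → ℝ} {q : ℝ}

theorem contDiff_and_integrable_of_gaussianReal_conv (hv : v ≠ 0) (hf : Measurable f)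
    (hq : 1 < q) {x₀ : ℝ}
    (hfq : Integrable (fun y => |f (x₀ + y)| ^ q) (gaussianReal 0 v ∗ m)) :
    ContDiff ℝ (⊤ : ℕ∞) (fun x => ∫ y, f (x + y) ∂(gaussianReal 0 v ∗ m)) ∧
    ∀ x, Integrable (fun y => f (x + y)) (gaussianReal 0 v ∗ m) := by
  rw [integrable_comp_add_conv_iff (f := fun z => |f z| ^ q) (by fun_prop)] at hfq
  obtain ⟨h1, h2⟩ := gaussian_smoothing hv hf hq hfq
  simp_rw [integral_comp_add_conv hf, integrable_comp_add_conv_iff hf]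
  exact ⟨h1, fun x => (h2 x).1⟩

/-- Differentiation commutes with the action of a convolution semigroup having a Gaussian
component. -/
theorem integral_deriv_comp_add_eq_deriv (hv : v ≠ 0) (hf : Measurable f) (hq : 1 < q) {x₀ : ℝ}
    (hfq : Integrable (fun y => |f (x₀ + y)| ^ q) (ρ ∗ (gaussianReal 0 v ∗ m))) (x : ℝ) :
    Integrable (fun y => deriv (fun x => ∫ z, f (x + z) ∂(gaussianReal 0 v ∗ m)) (x + y)) ρ ∧
    ∫ y, deriv (fun x => ∫ z, f (x + z) ∂(gaussianReal 0 v ∗ m)) (x + y) ∂ρ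
      = deriv (fun x => ∫ z, f (x + z) ∂(ρ ∗ (gaussianReal 0 v ∗ m))) x := by
  obtain ⟨y₀, hy₀⟩ := exists_integrable_comp_add_of_conv (f := fun y => |f (x₀ + y)| ^ q)
    (by fun_prop) hfq
  simp_rw [← add_assoc] at hy₀
  rw [integrable_comp_add_conv_iff (f := fun z => |f z| ^ q) (by fun_prop)] at hy₀
  have hsmall := (gaussian_smoothing hv hf hq hy₀).2
  have hcomm : ρ ∗ (gaussianReal 0 v ∗ m) = gaussianReal 0 v ∗ (ρ ∗ m) := by
    rw [← Measure.conv_assoc, Measure.conv_comm ρ, Measure.conv_assoc]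
  rw [hcomm] at hfq ⊢
  rw [integrable_comp_add_conv_iff (f := fun z => |f z| ^ q) (by fun_prop)] at hfq
  obtain ⟨-, hint, hder⟩ := (gaussian_smoothing hv hf hq hfq).2 x
  simp_rw [integral_comp_add_conv hf]
  simp_rw [(hsmall _).2.2.deriv, hder.deriv]
  have hmp := measurePreserving_prod_conv (ρ := ρ) (κ := gaussianReal 0 v) (m := m)
  have hmeas : Measurable fun p : ℝ × ℝ => p.1 * f (x + (p.1 + p.2)) := by fun_prop
  have hint3 := (hmp.integrable_comp hmeas.aestronglyMeasurable).2 hint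
  have heq := integral_map (μ := ρ.prod ((gaussianReal 0 v).prod m)) hmp.measurable.aemeasurable
    (f := fun p : ℝ × ℝ => p.1 * f (x + (p.1 + p.2))) hmeas.aestronglyMeasurable
  rw [hmp.map_eq] at heq
  have hswap (y g w : ℝ) : x + (g + (y + w)) = x + y + (g + w) := by ring
  simp only [Function.comp_def, hswap] at hint3
  rw [integral_div, heq]
  simp only [hswap]
  rw [integral_prod _ hint3]
  exact ⟨hint3.integral_prod_left.div_const _, rfl⟩

end Semigroup

/-- for a Lévy process with `σ > 0` and a Borel `f` with
`𝔼|f(X_T)|^q < ∞`, `q > 1`: `f(x + X_{T-t})` is integrable for all `(t,x)`,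
`x ↦ F(t,x) = 𝔼 f(x + X_{T-t})` is `C^∞` for `t ∈ [0,T)`, and
`𝔼[∂_x F(t,X_t)|ℱ_s] = ∂_x F(s,X_s)` a.s. for `0 ≤ s < t < T`. -/
theorem stmt18 {Ω : Type*} {m0 : MeasurableSpace Ω} (μ : Measure Ω) [IsProbabilityMeasure μ]
    (T : ℝ) (hT : 0 < T)
    (γ σ : ℝ) (hσ : 0 < σ) (ν : Measure ℝ) (hν : IsLevyMeasure ν)
    (X : ℝ → Ω → ℝ) (ℱ : Filtration ℝ m0)
    (hX : IsLevyProcess μ ℱ X γ σ ν)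
    (f : ℝ → ℝ) (hf : Measurable f)
    (q : ℝ) (hq : 1 < q)
    (hfq : Integrable (fun ω => |f (X T ω)| ^ q) μ) :
    (∀ t ∈ Set.Icc (0 : ℝ) T, ∀ x : ℝ,
      Integrable (fun ω => f (x + X (T - t) ω)) μ) ∧
    (∀ t ∈ Set.Ico (0 : ℝ) T,
      ContDiff ℝ (⊤ : ℕ∞) (fun x => ∫ ω, f (x + X (T - t) ω) ∂μ)) ∧
    (∀ s t : ℝ, 0 ≤ s → s < t → t < T →
      (μ[fun ω => deriv (fun x => ∫ ω', f (x + X (T - t) ω') ∂μ) (X t ω)|ℱ s])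
        =ᵐ[μ] fun ω => deriv (fun x => ∫ ω', f (x + X (T - s) ω') ∂μ) (X s ω)) := by
  have hXm (τ : ℝ) : Measurable (X τ) := (hX.1 τ).mono (ℱ.le τ) le_rfl
  have hprob (τ : ℝ) : IsProbabilityMeasure (μ.map (X τ)) :=
    Measure.isProbabilityMeasure_map (hXm τ).aemeasurable
  have hF (τ x : ℝ) : ∫ ω, f (x + X τ ω) ∂μ = ∫ y, f (x + y) ∂μ.map (X τ) :=
    (integral_map (hXm τ).aemeasurable
      (hf.comp (measurable_const_add x)).aestronglyMeasurable).symm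
  have hFint (τ x : ℝ) :
      Integrable (fun ω => f (x + X τ ω)) μ ↔ Integrable (fun y => f (x + y)) (μ.map (X τ)) :=
    (integrable_map_measure (hf.comp (measurable_const_add x)).aestronglyMeasurable
      (hXm τ).aemeasurable).symm
  have hfT : Integrable (fun y => |f y| ^ q) (μ.map (X T)) :=
    (integrable_map_measure
      (by fun_prop : Measurable fun y => |f y| ^ q).aestronglyMeasurable
      (hXm T).aemeasurable).2 hfq
  have hfT' {t τ : ℝ} (ht : 0 ≤ t) (hτ : 0 ≤ τ) (h : t + τ = T) :
      Integrable (fun y => |f y| ^ q) (μ.map (X t) ∗ μ.map (X τ)) := by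
    rwa [← map_eq_conv_of_isLevyProcess hX ht hτ, h]
  have hshift {t τ : ℝ} (ht : 0 ≤ t) (hτ : 0 ≤ τ) (h : t + τ = T) :
      ∃ x₀, Integrable (fun y => |f (x₀ + y)| ^ q) (μ.map (X τ)) :=
    exists_integrable_comp_add_of_conv (f := fun y => |f y| ^ q) (by fun_prop) (hfT' ht hτ h)
  have hv {τ : ℝ} (hτ : 0 < τ) : (σ ^ 2 * τ).toNNReal ≠ 0 := by
    have : 0 < σ ^ 2 * τ := by positivity
    simpa using this
  have hsmooth {t : ℝ} (ht : t ∈ Set.Ico 0 T) :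
      ContDiff ℝ (⊤ : ℕ∞) (fun x => ∫ y, f (x + y) ∂μ.map (X (T - t))) ∧
        ∀ x, Integrable (fun y => f (x + y)) (μ.map (X (T - t))) := by
    have hτ : 0 < T - t := sub_pos.2 ht.2
    obtain ⟨x₀, hx₀⟩ := hshift ht.1 hτ.le (add_sub_cancel t T)
    obtain ⟨m, hm, heq⟩ := exists_map_eq_gaussianReal_conv_of_isLevyProcess hν hX hτ.le
    rw [heq] at hx₀ ⊢
    exact contDiff_and_integrable_of_gaussianReal_conv (hv hτ) hf hq hx₀
  simp_rw [hF, hFint]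
  refine ⟨fun t ht x => ?_, fun t ht => (hsmooth ht).1, fun s t hs hst htT => ?_⟩
  · rcases ht.2.eq_or_lt with rfl | htT
    · rw [sub_self, ← hFint]
      simp [hX.2.1]
    · exact (hsmooth ⟨ht.1, htT⟩).2 x
  have ht : 0 ≤ t := hs.trans hst.le
  have hτ : 0 < T - t := sub_pos.2 htT
  obtain ⟨m, hm, heq⟩ := exists_map_eq_gaussianReal_conv_of_isLevyProcess hν hX hτ.le
  set D : Ω → ℝ := fun ω => X t ω - X s ω
  have hD : Measurable D := (hXm t).sub (hXm s)
  have hDmap : μ.map D = μ.map (X (t - s)) := hX.2.2.2.2.1 s t hs hst.le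
  set φ : ℝ → ℝ := deriv fun x => ∫ y, f (x + y) ∂μ.map (X (T - t))
  have hφ : Measurable φ := measurable_deriv _
  have hXt (ω : Ω) : X t ω = X s ω + D ω := (add_sub_cancel _ _).symm
  have hint : Integrable (fun ω => φ (X s ω + D ω)) μ := by
    have h0 := hfT' ht hτ.le (add_sub_cancel t T)
    rw [heq] at h0
    have h1 := (integral_deriv_comp_add_eq_deriv (x₀ := 0) (hv hτ) hf hq (by simpa using h0) 0).1
    rw [← heq] at h1
    simp only [zero_add] at h1
    simp_rw [← hXt]
    exact (integrable_map_measure hφ.aestronglyMeasurable (hXm t).aemeasurable).1 h1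
  have hcond := condExp_comp_add_of_indep (ℱ.le s) (hX.1 s) hD
    (hX.2.2.2.1 s t hs hst.le) hφ hint
  simp_rw [hXt]
  refine hcond.trans (ae_of_all _ fun ω => ?_)
  obtain ⟨x₀, hx₀⟩ := hshift hs (hτ.trans (by linarith : T - t < T - s)).le (add_sub_cancel s T)
  have hsemi : μ.map (X (T - s)) = μ.map (X (t - s)) ∗ μ.map (X (T - t)) := by
    rw [← map_eq_conv_of_isLevyProcess hX (sub_nonneg.2 hst.le) hτ.le]
    congr 2
    ring
  rw [hsemi, heq] at hx₀
  have h1 := (integral_deriv_comp_add_eq_deriv (hv hτ) hf hq hx₀ (X s ω)).2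
  rw [← heq, ← hsemi] at h1
  rw [hDmap]
  exact h1
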